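/- Let f : ℝ → ℝ be C¹ with f = 0 on (−∞,0], m > 1, and suppose t ↦ f(t)/t^{m−1} is increasing on (0,∞). Then Q(s) = (1/m)f(s)s − F(s) is nondecreasing on [0,∞) and Q(s) ≥ 0 for s ≥ 0, where F(s) = ∫₀^s f(τ)dτ. -/

import Mathlib

open Real MeasureTheory

theorem stmt_9 (f F : ℝ → ℝ) (m : ℝ)
    (hf : ContDiff ℝ 1 f)
    (hfzero : ∀ t : ℝ, t ≤ 0 → f t = 0)
    (hF : ∀ t : ℝ, F t = ∫ s in (0:ℝ)..t, f s)
    (hm : 1 < m)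
    (hinc : StrictMonoOn (fun t => f t / t ^ (m - 1)) (Set.Ioi 0)) :
    MonotoneOn (fun s => (1 / m) * f s * s - F s) (Set.Ici 0) ∧
    ∀ s : ℝ, 0 ≤ s → 0 ≤ (1 / m) * f s * s - F s := by
  have hd : ∀ x, HasDerivAt f (deriv f x) x := fun x =>
    (hf.differentiable (by norm_num) x).hasDerivAt
  have hFd : ∀ x, HasDerivAt F (f x) x := by
    intro x
    have : F = fun t => ∫ s in (0:ℝ)..t, f s := funext hF
    rw [this]
    exact hf.continuous.integral_hasStrictDerivAt 0 x |>.hasDerivAt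
  have hQ : ∀ x, HasDerivAt (fun s => (1 / m) * f s * s - F s)
      ((1 / m) * deriv f x * x + (1 / m) * f x * 1 - f x) x := fun x =>
    (((hd x).const_mul (1 / m)).mul (hasDerivAt_id x)).sub (hFd x)
  have hmono : MonotoneOn (fun s => (1 / m) * f s * s - F s) (Set.Ici 0) := by
    refine monotoneOn_of_deriv_nonneg (convex_Ici 0)
      (fun x _ => (hQ x).continuousAt.continuousWithinAt)
      (fun x _ => (hQ x).differentiableAt.differentiableWithinAt) ?_
    intro x hx
    rw [interior_Ici] at hx
    have hx0 : 0 < x := hx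
    rw [(hQ x).deriv]
    have hp : 0 < x ^ (m - 1) := rpow_pos_of_pos hx0 _
    have h1 := (hd x).div (Real.hasDerivAt_rpow_const (p := m - 1) (Or.inl hx0.ne')) hp.ne'
    have h2 := hinc.monotoneOn.derivWithin_nonneg (x := x)
    rw [derivWithin_of_isOpen isOpen_Ioi hx] at h2
    have h3 : 0 ≤ (deriv f x * x ^ (m - 1) - f x * ((m - 1) * x ^ (m - 1 - 1))) /
        (x ^ (m - 1)) ^ 2 := by
      rw [← h1.deriv]; exact h2
    rw [rpow_sub_one hx0.ne' (m - 1)] at h3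
    have h4 : (deriv f x * x ^ (m - 1) - f x * ((m - 1) * (x ^ (m - 1) / x))) /
        (x ^ (m - 1)) ^ 2 = (deriv f x * x - (m - 1) * f x) / (x * x ^ (m - 1)) := by
      field_simp
    rw [h4] at h3
    have h5 : 0 ≤ deriv f x * x - (m - 1) * f x := by
      by_contra h
      exact absurd h3 (not_le.mpr (div_neg_of_neg_of_pos (not_le.mp h) (by positivity)))
    have h6 : (1 / m) * deriv f x * x + (1 / m) * f x * 1 - f x
        = (deriv f x * x - (m - 1) * f x) / m := by
      field_simp
      ring
    rw [h6]
    exact div_nonneg h5 (by linarith)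
  refine ⟨hmono, fun s hs => ?_⟩
  have := hmono (Set.mem_Ici.mpr le_rfl) (Set.mem_Ici.mpr hs) hs
  simpa [hF 0] using this
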